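/- arXiv:2203.04879 — 2 statements merged into one kernel-verified Lean document; each statement's English description precedes it below -/
import Mathlib

section
/- There is no consistent recursively axiomatized theory S extending RKf, with a standard provability predicate Bew_S satisfying the Hilbert–Bernays–Löb derivability conditions, such that S proves the global probabilistic reflection principle ∀x (Bew_S(x) → Pr(x) = 1). -/
/-!
Abstract arithmetized syntax for the language `L_Q = L_{Q⁻} ∪ {Pr}` of
Cieśliński–Horsten–Leitgeb, *Axioms for Typefree Subjective Probability*.

`Sen` is the type of (codes of) `L_Q`-sentences.  The fields provide the
arithmetized logical operations on codes (dotted connectives), distinguished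
atoms expressing facts about the two-place probability predicate `Pr`
(`Pr(x, y)`, also written `Pr(x) = y`), the collection `Base` of (codes of)
sentences of the mathematical base language `L_{Q⁻}`, and the axiom set
`QAx` of the background theory `Q`: a standard classical first-order theory
`Q⁻` of the rational numbers, whose language contains a predicate `N` for
the natural numbers and the Peano axioms relativized to `N`, with all
logical and nonlogical schemes extended to the full language `L_Q`.
The `q_*` fields record that `QAx` contains (at least) all axioms of
classical propositional logic for the full language `L_Q`.
-/
structure LQ where
  /-- (codes of) sentences of `L_Q` -/
  Sen : Type
  /-- arithmetized negation -/
  neg : Sen → Sen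
  /-- arithmetized conditional -/
  imp : Sen → Sen → Sen
  /-- arithmetized disjunction -/
  orS : Sen → Sen → Sen
  /-- arithmetized conjunction -/
  andS : Sen → Sen → Sen
  /-- arithmetized biconditional -/
  iffS : Sen → Sen → Sen
  /-- a fixed contradictory sentence `⊥` -/
  bot : Sen
  /-- `prEq φ a` is (the code of) the object sentence `Pr(⌜φ⌝) = a` -/
  prEq : Sen → ℚ → Sen
  /-- `prLtOne φ` is the object sentence `Pr(⌜φ⌝) < 1` -/
  prLtOne : Sen → Sen
  /-- `prGe φ ψ` is the object sentence `Pr(⌜φ⌝) ≥ Pr(⌜ψ⌝)` -/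
  prGe : Sen → Sen → Sen
  /-- `prIn φ a b` is the object sentence `Pr(⌜φ⌝) ∈ [a, b]` -/
  prIn : Sen → ℚ → ℚ → Sen
  /-- (codes of) sentences of the mathematical base language `L_{Q⁻}` -/
  Base : Set Sen
  /-- the axioms of the background theory `Q` -/
  QAx : Set Sen
  q_imp_k : ∀ φ ψ, imp φ (imp ψ φ) ∈ QAx
  q_imp_s : ∀ φ ψ χ, imp (imp φ (imp ψ χ)) (imp (imp φ ψ) (imp φ χ)) ∈ QAx
  q_dne : ∀ φ, imp (neg (neg φ)) φ ∈ QAx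
  q_bot : ∀ φ, imp bot φ ∈ QAx
  q_neg_elim : ∀ φ, imp φ (imp (neg φ) bot) ∈ QAx
  q_neg_intro : ∀ φ, imp (imp φ bot) (neg φ) ∈ QAx
  q_and_intro : ∀ φ ψ, imp φ (imp ψ (andS φ ψ)) ∈ QAx
  q_and_left : ∀ φ ψ, imp (andS φ ψ) φ ∈ QAx
  q_and_right : ∀ φ ψ, imp (andS φ ψ) ψ ∈ QAx
  q_or_inl : ∀ φ ψ, imp φ (orS φ ψ) ∈ QAx
  q_or_inr : ∀ φ ψ, imp ψ (orS φ ψ) ∈ QAx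
  q_or_elim : ∀ φ ψ χ, imp (imp φ χ) (imp (imp ψ χ) (imp (orS φ ψ) χ)) ∈ QAx
  q_iff_intro : ∀ φ ψ, imp (imp φ ψ) (imp (imp ψ φ) (iffS φ ψ)) ∈ QAx
  q_iff_mp : ∀ φ ψ, imp (iffS φ ψ) (imp φ ψ) ∈ QAx
  q_iff_mpr : ∀ φ ψ, imp (iffS φ ψ) (imp ψ φ) ∈ QAx

/-- The axioms of the theory `RKf` ("Reflexive Kolmogorov Finite") of finitely
additive typefree subjective probability.  Object-level universally quantified
axioms are rendered schematically, by the families of all their instances.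
The final constructors (`ltOfEq` … `notInOfEq`) record `Q`-provable links
between the probability atoms `prEq`, `prLtOne`, `prGe`, `prIn`
(consequences of `Q` together with Kf2, Kf3 and Kf7, `Pr` being a total
function on sentences with values in `[0,1]`). -/
inductive KfAx (L : LQ) : L.Sen → Prop
  /-- Kf1: the background theory `Q` -/
  | q {φ} (h : φ ∈ L.QAx) : KfAx L φ
  /-- Kf2: `Pr` is a function -/
  | func (φ : L.Sen) {a b : ℚ} (h : a ≠ b) :
      KfAx L (L.imp (L.prEq φ a) (L.neg (L.prEq φ b)))
  /-- Kf3: `0 ≤ Pr(φ) ≤ 1` -/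
  | range (φ : L.Sen) {a : ℚ} (h : ¬ (0 ≤ a ∧ a ≤ 1)) :
      KfAx L (L.neg (L.prEq φ a))
  /-- Kf4 (constant-term instances): `Pr(φ) = 1 ↔ φ` for `φ ∈ L_{Q⁻}` -/
  | baseRefl {φ} (h : φ ∈ L.Base) : KfAx L (L.iffS (L.prEq φ 1) φ)
  /-- Kf5: `Pr(φ) ≤ Pr(φ ∨ ψ)` -/
  | monoOrLeft (φ ψ : L.Sen) : KfAx L (L.prGe (L.orS φ ψ) φ)
  /-- Kf5: `Pr(ψ) ≤ Pr(φ ∨ ψ)` -/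
  | monoOrRight (φ ψ : L.Sen) : KfAx L (L.prGe (L.orS φ ψ) ψ)
  /-- Kf6: `Pr(φ ∨ ψ) = Pr(φ) + Pr(ψ) − Pr(φ ∧ ψ)` -/
  | add (φ ψ : L.Sen) (a b c : ℚ) :
      KfAx L (L.imp
        (L.andS (L.prEq φ a) (L.andS (L.prEq ψ b) (L.prEq (L.andS φ ψ) c)))
        (L.prEq (L.orS φ ψ) (a + b - c)))
  /-- Kf7: `Pr(¬φ) = 1 − Pr(φ)` -/
  | negPr (φ : L.Sen) (a : ℚ) :
      KfAx L (L.imp (L.prEq φ a) (L.prEq (L.neg φ) (1 - a)))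
  /-- Kf7 together with Kf2 (totality/functionality of `Pr`) -/
  | negPr' (φ : L.Sen) (a : ℚ) :
      KfAx L (L.imp (L.prEq (L.neg φ) a) (L.prEq φ (1 - a)))
  | ltOfEq (φ : L.Sen) {a : ℚ} (h : a < 1) :
      KfAx L (L.imp (L.prEq φ a) (L.prLtOne φ))
  | notEqOfLt (φ : L.Sen) : KfAx L (L.imp (L.prLtOne φ) (L.neg (L.prEq φ 1)))
  | ltOfNotEq (φ : L.Sen) : KfAx L (L.imp (L.neg (L.prEq φ 1)) (L.prLtOne φ))
  | geOfEq (φ ψ : L.Sen) {a b : ℚ} (h : b ≤ a) :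
      KfAx L (L.imp (L.andS (L.prEq φ a) (L.prEq ψ b)) (L.prGe φ ψ))
  | eqOneOfGe (φ ψ : L.Sen) :
      KfAx L (L.imp (L.andS (L.prGe φ ψ) (L.prEq ψ 1)) (L.prEq φ 1))
  | inOfEq (φ : L.Sen) {a b c : ℚ} (h1 : a ≤ c) (h2 : c ≤ b) :
      KfAx L (L.imp (L.prEq φ c) (L.prIn φ a b))
  | notInOfEq (φ : L.Sen) {a b c : ℚ} (h : ¬ (a ≤ c ∧ c ≤ b)) :
      KfAx L (L.imp (L.prEq φ c) (L.neg (L.prIn φ a b)))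

/-- Provability, in classical logic, from the axiom set `Ax` (which is
intended to contain the axioms of `Q`, in particular all logical axioms),
closed under modus ponens and under the necessitation rule Kf8:
from a proof of `φ`, infer `Pr(φ) = 1`. -/
inductive Thm (L : LQ) (Ax : L.Sen → Prop) : L.Sen → Prop
  | ax {φ} (h : Ax φ) : Thm L Ax φ
  | mp {φ ψ} (h1 : Thm L Ax (L.imp φ ψ)) (h2 : Thm L Ax φ) : Thm L Ax ψ
  /-- Kf8 (necessitation) -/
  | nec {φ} (h : Thm L Ax φ) : Thm L Ax (L.prEq φ 1)

/-- Derivable implications compose. -/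
theorem Thm.imp_trans {L : LQ} {Ax : L.Sen → Prop} (hQ : ∀ φ ∈ L.QAx, Ax φ)
    {φ ψ χ : L.Sen} (h₁ : Thm L Ax (L.imp φ ψ)) (h₂ : Thm L Ax (L.imp ψ χ)) :
    Thm L Ax (L.imp φ χ) :=
  .mp (.mp (.ax (hQ _ (L.q_imp_s φ ψ χ))) (.mp (.ax (hQ _ (L.q_imp_k _ φ))) h₂)) h₁

/-- A sentence that implies a refutable sentence is refutable. -/
theorem Thm.neg_of_imp {L : LQ} {Ax : L.Sen → Prop} (hQ : ∀ φ ∈ L.QAx, Ax φ)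
    {φ ψ : L.Sen} (h : Thm L Ax (L.imp φ ψ)) (hψ : Thm L Ax (L.neg ψ)) :
    Thm L Ax (L.neg φ) := by
  refine .mp (.ax (hQ _ (L.q_neg_intro φ))) (h.imp_trans hQ ?_)
  exact .mp (.mp (.ax (hQ _ (L.q_imp_s ψ (L.neg ψ) L.bot))) (.ax (hQ _ (L.q_neg_elim ψ))))
    (.mp (.ax (hQ _ (L.q_imp_k _ ψ))) hψ)

/-- Extensions of `RKf` refute `Pr(⊥) = 1`. -/
theorem Thm.neg_prEq_bot_one {L : LQ} {Ax : L.Sen → Prop} (hAx : ∀ φ, KfAx L φ → Ax φ) :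
    Thm L Ax (L.neg (L.prEq L.bot 1)) := by
  have h_neg : Thm L Ax (L.neg L.bot) :=
    .mp (.ax (hAx _ (.q (L.q_neg_intro L.bot)))) (.ax (hAx _ (.q (L.q_bot L.bot))))
  have h_zero : Thm L Ax (L.prEq L.bot (1 - 1)) :=
    .mp (.ax (hAx _ (.negPr' L.bot 1))) (.nec h_neg)
  exact .mp (.ax (hAx _ (.func L.bot (by norm_num)))) h_zero

/-- Proposition 2.  There is no consistent recursively
axiomatized theory `S` extending `RKf`, with a standard provability predicate
`Bew_S` satisfying the Hilbert–Bernays–Löb derivability conditions, such that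
`S` proves the global probabilistic reflection principle
`∀x (Bew_S(x) → Pr(x) = 1)`.

Here `SAx` is the axiom set of `S` (so that `Thm L SAx` is provability in
`S`, which extends `RKf` by `hS` and is closed under necessitation), `Bew`
is the arithmetized provability predicate of `S` (`d1`–`d3` are the HBL
derivability conditions and `g2` is Gödel's second incompleteness theorem
for the recursively axiomatized `S`, `diag` an instance of the diagonal
lemma), `refl` is the single object sentence `∀x (Bew_S(x) → Pr(x) = 1)`
and `hinst` is its universal instantiation.  The conclusion: such an `S`
is inconsistent. -/
theorem no_consistent_global_probabilistic_reflection (L : LQ)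
    (SAx : L.Sen → Prop) (hS : ∀ φ, KfAx L φ → SAx φ)
    (Bew : L.Sen → L.Sen)
    (d1 : ∀ φ, Thm L SAx φ → Thm L SAx (Bew φ))
    (d2 : ∀ φ ψ, Thm L SAx (L.imp (Bew (L.imp φ ψ)) (L.imp (Bew φ) (Bew ψ))))
    (d3 : ∀ φ, Thm L SAx (L.imp (Bew φ) (Bew (Bew φ))))
    (g2 : ¬ Thm L SAx L.bot → ¬ Thm L SAx (L.neg (Bew L.bot)))
    (diag : ∃ lam : L.Sen,
      Thm L SAx (L.iffS lam (L.neg (L.imp (Bew lam) (L.prEq lam 1)))))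
    (refl : L.Sen)
    (hinst : ∀ φ : L.Sen,
      Thm L SAx (L.imp refl (L.imp (Bew φ) (L.prEq φ 1))))
    (hrefl : Thm L SAx refl) :
    Thm L SAx L.bot := by
  by_contra h_con
  exact g2 h_con <| (Thm.mp (hinst L.bot) hrefl).neg_of_imp (fun φ hφ => hS φ (.q hφ))
    (Thm.neg_prEq_bot_one hS)
end

section
/- There is no consistent recursively axiomatized theory S extending RKf, with a standard provability predicate Bew_S satisfying the Hilbert–Bernays–Löb derivability conditions, such that S proves every instance of the local reflection schema Bew_S(φ) → Pr(φ) = 1, where φ ranges over all L_Q-sentences. -/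
namespace Thm

variable {L : LQ} {Ax : L.Sen → Prop}

theorem of_mem_qAx (hAx : ∀ φ, KfAx L φ → Ax φ) {φ : L.Sen} (h : φ ∈ L.QAx) : Thm L Ax φ :=
  .ax (hAx _ (.q h))

theorem imp_of_right (hAx : ∀ φ, KfAx L φ → Ax φ) (φ : L.Sen) {ψ : L.Sen}
    (h : Thm L Ax ψ) : Thm L Ax (L.imp φ ψ) :=
  .mp (of_mem_qAx hAx (L.q_imp_k ψ φ)) h

theorem imp_mp (hAx : ∀ φ, KfAx L φ → Ax φ) {φ ψ χ : L.Sen}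
    (h₁ : Thm L Ax (L.imp φ (L.imp ψ χ))) (h₂ : Thm L Ax (L.imp φ ψ)) :
    Thm L Ax (L.imp φ χ) :=
  .mp (.mp (of_mem_qAx hAx (L.q_imp_s φ ψ χ)) h₁) h₂

theorem imp_trans_s2 (hAx : ∀ φ, KfAx L φ → Ax φ) {φ ψ χ : L.Sen}
    (h₁ : Thm L Ax (L.imp φ ψ)) (h₂ : Thm L Ax (L.imp ψ χ)) : Thm L Ax (L.imp φ χ) :=
  imp_mp hAx (imp_of_right hAx φ h₂) h₁

theorem modus_tollens (hAx : ∀ φ, KfAx L φ → Ax φ) {φ ψ : L.Sen}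
    (h₁ : Thm L Ax (L.imp φ ψ)) (h₂ : Thm L Ax (L.neg ψ)) : Thm L Ax (L.neg φ) :=
  .mp (of_mem_qAx hAx (L.q_neg_intro φ))
    (imp_mp hAx (imp_trans_s2 hAx h₁ (of_mem_qAx hAx (L.q_neg_elim ψ))) (imp_of_right hAx φ h₂))

theorem neg_prEq_one_of_neg (hAx : ∀ φ, KfAx L φ → Ax φ) {φ : L.Sen}
    (h : Thm L Ax (L.neg φ)) : Thm L Ax (L.neg (L.prEq φ 1)) :=
  .mp (.ax (hAx _ (.func φ (by norm_num)))) (.mp (.ax (hAx _ (.negPr' φ 1))) (.nec h))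

theorem neg_bot (hAx : ∀ φ, KfAx L φ → Ax φ) : Thm L Ax (L.neg L.bot) :=
  .mp (of_mem_qAx hAx (L.q_neg_intro L.bot)) (of_mem_qAx hAx (L.q_bot L.bot))

end Thm

/-- remark following Proposition 2.  There is no consistent
recursively axiomatized theory `S` extending `RKf`, with a standard
provability predicate `Bew_S` satisfying the Hilbert–Bernays–Löb
derivability conditions, such that `S` proves every instance of the local
reflection schema `Bew_S(φ) → Pr(φ) = 1`, where `φ` ranges over all
`L_Q`-sentences.

`SAx` is the axiom set of `S` (so `Thm L SAx` is provability in `S`, which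
extends `RKf` by `hS` and is closed under necessitation), `d1`–`d3` are the
HBL derivability conditions, `g2` is Gödel's second incompleteness theorem
for the recursively axiomatized `S`, `diag` is an instance of the diagonal
lemma, and `hrefl` says that `S` proves every instance of the local
reflection schema.  The conclusion: such an `S` is inconsistent. -/
theorem no_consistent_local_probabilistic_reflection (L : LQ)
    (SAx : L.Sen → Prop) (hS : ∀ φ, KfAx L φ → SAx φ)
    (Bew : L.Sen → L.Sen)
    (d1 : ∀ φ, Thm L SAx φ → Thm L SAx (Bew φ))
    (d2 : ∀ φ ψ, Thm L SAx (L.imp (Bew (L.imp φ ψ)) (L.imp (Bew φ) (Bew ψ))))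
    (d3 : ∀ φ, Thm L SAx (L.imp (Bew φ) (Bew (Bew φ))))
    (g2 : ¬ Thm L SAx L.bot → ¬ Thm L SAx (L.neg (Bew L.bot)))
    (diag : ∃ lam : L.Sen,
      Thm L SAx (L.iffS lam (L.neg (L.imp (Bew lam) (L.prEq lam 1)))))
    (hrefl : ∀ φ : L.Sen, Thm L SAx (L.imp (Bew φ) (L.prEq φ 1))) :
    Thm L SAx L.bot := by
  by_contra hcon
  exact g2 hcon
    (Thm.modus_tollens hS (hrefl L.bot) (Thm.neg_prEq_one_of_neg hS (Thm.neg_bot hS)))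
end
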